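/- arXiv:2209.08024 — 2 statements merged into one kernel-verified Lean document; each statement's English description precedes it below -/
import Mathlib

section
/- For every α ∈ [1/2, 1) there exists a sequence of instances (𝒯_n, w_n), where each 𝒯_n is a finite tree and w_n a weight function with w_n(𝒯_n) = 1, such that lim_{n→∞} OPT(𝒯_n, w_n) = ∞ and for every n, cent^α(𝒯_n, w_n) ≥ (1/(1−α))·OPT(𝒯_n, w_n) − α/(1−α). -/
open Filter Topology

universe u

variable {V : Type u}

/-- Rooted trees with vertices labelled by elements of `V`. -/
inductive RTree (V : Type u) : Type u where
  | node : V → List (RTree V) → RTree V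

namespace RTree

/-- The root of a rooted tree. -/
def root : RTree V → V
  | node r _ => r

/-- The subtrees rooted at the children of the root. -/
def children : RTree V → List (RTree V)
  | node _ ts => ts

/-- The list of pairs `(v, path from the root to v)` over all vertices `v` of the tree. -/
def pathsFrom : RTree V → List (V × List V)
  | node r ts =>
      (r, [r]) ::
        (ts.attach.map fun t => (t.1.pathsFrom.map fun p => (p.1, r :: p.2))).flatten
  decreasing_by
    simp only [RTree.node.sizeOf_spec]
    have := List.sizeOf_lt_of_mem t.2
    omega

/-- The vertex set of a rooted tree. -/
def vertSet (T : RTree V) : Set V := {v | ∃ p ∈ T.pathsFrom, p.1 = v}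

/-- `Path_T(v)`: the set of vertices on the path in `T` from the root to `v`
(including both endpoints). -/
def pathSet (T : RTree V) (v : V) : Set V := {x | ∃ p ∈ T.pathsFrom, p.1 = v ∧ x ∈ p.2}

/-- The depth of a vertex `v` in `T`; the root has depth 1. -/
noncomputable def depth (T : RTree V) (v : V) : ℕ := (T.pathSet v).ncard

/-- All subtrees of a rooted tree (including the tree itself). -/
def allSubtrees : RTree V → List (RTree V)
  | node r ts => node r ts :: (ts.attach.map fun t => t.1.allSubtrees).flatten
  decreasing_by
    simp only [RTree.node.sizeOf_spec]
    have := List.sizeOf_lt_of_mem t.2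
    omega

/-- Two rooted trees are equivalent (represent the same search tree) if they have
the same root-to-vertex paths. -/
def Equiv (T₁ T₂ : RTree V) : Prop := ∀ v, T₁.pathSet v = T₂.pathSet v

end RTree

/-- `x` and `y` are joined by a walk of `G` staying inside `s`. -/
def ReachIn (G : SimpleGraph V) (s : Set V) (x y : V) : Prop :=
  ∃ p : G.Walk x y, ∀ v ∈ p.support, v ∈ s

/-- The connected component of `x` in the subgraph of `G` induced by `s`. -/
def compIn (G : SimpleGraph V) (s : Set V) (x : V) : Set V := {y | ReachIn G s x y}

/-- The set of connected components of the subgraph of `G` induced by `s`. -/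
def comps (G : SimpleGraph V) (s : Set V) : Set (Set V) := {c | ∃ x ∈ s, c = compIn G s x}

/-- `s` induces a (nonempty) connected subgraph of `G`. -/
def ConnIn (G : SimpleGraph V) (s : Set V) : Prop :=
  s.Nonempty ∧ ∀ x ∈ s, ∀ y ∈ s, ReachIn G s x y

/-- The total weight of a set of vertices. -/
noncomputable def wsum (w : V → ℝ) (s : Set V) : ℝ := ∑ᶠ x ∈ s, w x

/-- `IsSearchTree G s T`: `T` is a search tree on the subgraph of `G` induced by `s`.
Its root `r` is a vertex of `s`, its vertex set is `s`, and the subtrees rooted at the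
children of `r` are search trees on the connected components of the induced subgraph
on `s \ {r}` (one subtree for each component). -/
inductive IsSearchTree (G : SimpleGraph V) : Set V → RTree V → Prop where
  | node {s : Set V} {r : V} {ts : List (RTree V)} :
      r ∈ s →
      (RTree.node r ts).vertSet = s →
      (∀ t ∈ ts, IsSearchTree G (compIn G (s \ {r}) t.root) t) →
      ts.Pairwise (fun t₁ t₂ => compIn G (s \ {r}) t₁.root ≠ compIn G (s \ {r}) t₂.root) →
      IsSearchTree G s (RTree.node r ts)

/-- The cost of a search tree: `∑_x w(x) · depth(x)`, the root having depth 1. -/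
noncomputable def cost (w : V → ℝ) (T : RTree V) : ℝ :=
  ∑ᶠ v ∈ T.vertSet, w v * (T.depth v : ℝ)

/-- The optimum cost of a search tree on the subgraph of `G` induced by `s`. -/
noncomputable def OPT (G : SimpleGraph V) (w : V → ℝ) (s : Set V) : ℝ :=
  sInf (cost w '' {T | IsSearchTree G s T})

/-- `v` is an `α`-centroid of the subgraph of `G` induced by `s` (with weights `w`):
every connected component of the induced subgraph on `s \ {v}` has weight at most
`α` times the weight of `s`. -/
def IsAlphaCentroid (G : SimpleGraph V) (w : V → ℝ) (α : ℝ) (s : Set V) (v : V) : Prop :=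
  v ∈ s ∧ ∀ x ∈ s \ {v}, wsum w (compIn G (s \ {v}) x) ≤ α * wsum w s

/-- `v` is a centroid of the subgraph of `G` induced by `s` (with weights `w`). -/
def IsCentroid (G : SimpleGraph V) (w : V → ℝ) (s : Set V) (v : V) : Prop :=
  v ∈ s ∧ ∀ x ∈ s \ {v}, wsum w (compIn G (s \ {v}) x) ≤ wsum w s / 2

/-- `T` is an `α`-centroid tree on the subgraph of `G` induced by `s`. -/
def IsAlphaCentroidTree (G : SimpleGraph V) (w : V → ℝ) (α : ℝ) (s : Set V) (T : RTree V) :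
    Prop :=
  IsSearchTree G s T ∧ ∀ t ∈ T.allSubtrees, IsAlphaCentroid G w α t.vertSet t.root

/-- `T` is a centroid tree on the subgraph of `G` induced by `s`. -/
def IsCentroidTree (G : SimpleGraph V) (w : V → ℝ) (s : Set V) (T : RTree V) : Prop :=
  IsSearchTree G s T ∧ ∀ t ∈ T.allSubtrees, IsCentroid G w t.vertSet t.root

/-- `cent(𝒯,w)`: the maximum cost of a centroid tree. -/
noncomputable def centCost (G : SimpleGraph V) (w : V → ℝ) (s : Set V) : ℝ :=
  sSup (cost w '' {T | IsCentroidTree G w s T})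

/-- `centᵅ(𝒯,w)`: the maximum cost of an `α`-centroid tree (`0` if none exists, since
`sSup ∅ = 0` in `ℝ`). -/
noncomputable def centCostA (G : SimpleGraph V) (w : V → ℝ) (α : ℝ) (s : Set V) : ℝ :=
  sSup (cost w '' {T | IsAlphaCentroidTree G w α s T})

/-- `b` is a child of `a` in the rooted tree `T`. -/
def ChildRel (T : RTree V) (a b : V) : Prop :=
  ∃ t ∈ T.allSubtrees, t.root = a ∧ ∃ t' ∈ t.children, t'.root = b

namespace RTree

theorem mem_pathsFrom_node {r : V} {ts : List (RTree V)} {p : V × List V} :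
    p ∈ (node r ts).pathsFrom ↔
      p = (r, [r]) ∨ ∃ t ∈ ts, ∃ q ∈ t.pathsFrom, p = (q.1, r :: q.2) := by
  rw [pathsFrom]
  simp only [List.mem_cons, List.mem_flatten, List.mem_map, List.mem_attach, true_and,
    Subtype.exists]
  constructor
  · rintro (h | ⟨_, ⟨t, ht, rfl⟩, hp⟩)
    · exact Or.inl h
    · obtain ⟨q, hq, rfl⟩ := List.mem_map.1 hp
      exact Or.inr ⟨t, ht, q, hq, rfl⟩
  · rintro (h | ⟨t, ht, q, hq, rfl⟩)
    · exact Or.inl h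
    · exact Or.inr ⟨_, ⟨t, ht, rfl⟩, List.mem_map.2 ⟨q, hq, rfl⟩⟩

theorem mem_vertSet_node {r : V} {ts : List (RTree V)} {x : V} :
    x ∈ (node r ts).vertSet ↔ x = r ∨ ∃ t ∈ ts, x ∈ t.vertSet := by
  simp only [vertSet, Set.mem_ofPred_eq, mem_pathsFrom_node]
  constructor
  · rintro ⟨p, rfl | ⟨t, ht, q, hq, rfl⟩, rfl⟩
    · exact Or.inl rfl
    · exact Or.inr ⟨t, ht, q, hq, rfl⟩
  · rintro (rfl | ⟨t, ht, q, hq, rfl⟩)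
    · exact ⟨_, Or.inl rfl, rfl⟩
    · exact ⟨_, Or.inr ⟨t, ht, q, hq, rfl⟩, rfl⟩

theorem root_mem_vertSet (T : RTree V) : T.root ∈ T.vertSet := by
  cases T
  exact mem_vertSet_node.2 (Or.inl rfl)

theorem vertSet_finite (T : RTree V) : T.vertSet.Finite := by
  classical
  refine (Finset.finite_toSet (T.pathsFrom.map Prod.fst).toFinset).subset ?_
  rintro x ⟨p, hp, rfl⟩
  simpa using ⟨_, hp⟩

theorem pathSet_finite (T : RTree V) (v : V) : (T.pathSet v).Finite := by
  classical
  refine (Finset.finite_toSet (T.pathsFrom.flatMap Prod.snd).toFinset).subset ?_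
  rintro x ⟨p, hp, -, hx⟩
  simp only [List.coe_toFinset, List.mem_flatMap, Set.mem_ofPred_eq]
  exact ⟨p, hp, hx⟩

theorem mem_allSubtrees_node {r : V} {ts : List (RTree V)} {t : RTree V} :
    t ∈ (node r ts).allSubtrees ↔ t = node r ts ∨ ∃ t' ∈ ts, t ∈ t'.allSubtrees := by
  rw [allSubtrees]
  simp only [List.mem_cons, List.mem_flatten, List.mem_map, List.mem_attach, true_and,
    Subtype.exists]
  constructor
  · rintro (h | ⟨_, ⟨t, ht, rfl⟩, hp⟩)
    · exact Or.inl h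
    · exact Or.inr ⟨t, ht, hp⟩
  · rintro (h | ⟨t, ht, hq⟩)
    · exact Or.inl h
    · exact Or.inr ⟨_, ⟨t, ht, rfl⟩, hq⟩

theorem pathSet_root {r : V} {ts : List (RTree V)} (hr : ∀ t ∈ ts, r ∉ t.vertSet) :
    (node r ts).pathSet r = {r} := by
  ext x
  simp only [pathSet, mem_pathsFrom_node, Set.mem_ofPred_eq, Set.mem_singleton_iff]
  constructor
  · rintro ⟨p, rfl | ⟨t, ht, q, hq, rfl⟩, h, hx⟩
    · simpa using hx
    · exact absurd ⟨q, hq, h⟩ (hr t ht)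
  · rintro rfl
    exact ⟨_, Or.inl rfl, rfl, by simp⟩

theorem pathSet_child {r v : V} {ts : List (RTree V)} {t : RTree V} (ht : t ∈ ts)
    (hv : v ∈ t.vertSet) (hvr : v ≠ r) (huniq : ∀ t' ∈ ts, v ∈ t'.vertSet → t' = t) :
    (node r ts).pathSet v = insert r (t.pathSet v) := by
  ext x
  simp only [pathSet, mem_pathsFrom_node, Set.mem_ofPred_eq, Set.mem_insert_iff]
  constructor
  · rintro ⟨p, rfl | ⟨t', ht', q, hq, rfl⟩, h, hx⟩
    · exact absurd h.symm hvr
    · obtain rfl := huniq t' ht' ⟨q, hq, h⟩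
      rcases List.mem_cons.1 hx with h' | h'
      · exact Or.inl h'
      · exact Or.inr ⟨q, hq, h, h'⟩
  · rintro (rfl | ⟨q, hq, h, hx⟩)
    · obtain ⟨q, hq, h⟩ := hv
      exact ⟨_, Or.inr ⟨t, ht, q, hq, rfl⟩, h, by simp⟩
    · exact ⟨_, Or.inr ⟨t, ht, q, hq, rfl⟩, h, by simp [hx]⟩

end RTree

section Reach

variable {G : SimpleGraph V} {s s' : Set V} {x y z : V}

theorem ReachIn.refl (hx : x ∈ s) : ReachIn G s x x := ⟨.nil, by simpa using hx⟩

theorem ReachIn.symm (h : ReachIn G s x y) : ReachIn G s y x := by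
  obtain ⟨p, hp⟩ := h
  exact ⟨p.reverse, by simpa using hp⟩

theorem ReachIn.trans (h : ReachIn G s x y) (h' : ReachIn G s y z) : ReachIn G s x z := by
  obtain ⟨p, hp⟩ := h
  obtain ⟨q, hq⟩ := h'
  refine ⟨p.append q, fun v hv => ?_⟩
  rcases (SimpleGraph.Walk.mem_support_append_iff _ _).1 hv with h | h
  exacts [hp v h, hq v h]

theorem ReachIn.of_adj (h : G.Adj x y) (hx : x ∈ s) (hy : y ∈ s) : ReachIn G s x y :=
  ⟨.cons h .nil, by simp [hx, hy]⟩

theorem ReachIn.mono (hs : s ⊆ s') (h : ReachIn G s x y) : ReachIn G s' x y := by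
  obtain ⟨p, hp⟩ := h
  exact ⟨p, fun v hv => hs (hp v hv)⟩

theorem ReachIn.left_mem (h : ReachIn G s x y) : x ∈ s := by
  obtain ⟨p, hp⟩ := h
  exact hp x p.start_mem_support

theorem ReachIn.right_mem (h : ReachIn G s x y) : y ∈ s := h.symm.left_mem

theorem compIn_eq_of_reachIn (h : ReachIn G s x y) : compIn G s x = compIn G s y := by
  ext z
  exact ⟨fun hz => h.symm.trans hz, fun hz => h.trans hz⟩

theorem ReachIn.mem_of_closed (h : ReachIn G s x y) {c : Set V} (hx : x ∈ c)
    (hc : ∀ a ∈ c, ∀ b ∈ s, G.Adj a b → b ∈ c) : ReachIn G c x y := by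
  obtain ⟨p, hp⟩ := h
  induction p with
  | nil => exact ReachIn.refl hx
  | cons hadj q ih =>
    simp only [SimpleGraph.Walk.support_cons, List.mem_cons, forall_eq_or_imp] at hp
    have hv := hc _ hx _ (hp.2 _ q.start_mem_support) hadj
    exact (ReachIn.of_adj hadj hx hv).trans (ih hv hp.2)

theorem compIn_eq_of_closed {c : Set V} (hcs : c ⊆ s) (hconn : ConnIn G c)
    (hc : ∀ a ∈ c, ∀ b ∈ s, G.Adj a b → b ∈ c) (hx : x ∈ c) : compIn G s x = c := by
  ext y
  exact ⟨fun h => (h.mem_of_closed hx hc).right_mem, fun hy => (hconn.2 x hx y hy).mono hcs⟩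

theorem connIn_compIn (hx : x ∈ s) : ConnIn G (compIn G s x) := by
  have hc : ∀ a ∈ compIn G s x, ∀ b ∈ s, G.Adj a b → b ∈ compIn G s x :=
    fun a ha b hb hab => ReachIn.trans ha (ReachIn.of_adj hab (ReachIn.right_mem ha) hb)
  exact ⟨⟨x, ReachIn.refl hx⟩, fun y hy z hz =>
    ((ReachIn.symm hy).trans hz).mem_of_closed hy hc⟩

theorem ReachIn.exists_adj_reachIn_diff (h : ReachIn G s x y) (hxy : x ≠ y) :
    ∃ z, G.Adj y z ∧ ReachIn G (s \ {y}) x z := by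
  obtain ⟨p, hp⟩ := h
  induction p with
  | nil => exact absurd rfl hxy
  | @cons a b c hadj q ih =>
    simp only [SimpleGraph.Walk.support_cons, List.mem_cons, forall_eq_or_imp] at hp
    have ha : a ∈ s \ {c} := ⟨hp.1, hxy⟩
    by_cases hb : b = c
    · subst hb
      exact ⟨a, hadj.symm, ReachIn.refl ha⟩
    · obtain ⟨z, hz, hr⟩ := ih hb hp.2
      exact ⟨z, hz, (ReachIn.of_adj hadj ha hr.left_mem).trans hr⟩

end Reach

/-- The vertex sets of two rooted trees are disjoint and not joined by an edge of `G`. -/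
def Separated (G : SimpleGraph V) (t₁ t₂ : RTree V) : Prop :=
  ∀ x ∈ t₁.vertSet, ∀ y ∈ t₂.vertSet, x ≠ y ∧ ¬ G.Adj x y

/-- Search trees on connected vertex sets, described without reference to components: the
subtrees at the children of a node are pairwise separated, and each contains a neighbour of
that node. -/
inductive IsConnSearchTree (G : SimpleGraph V) : RTree V → Prop where
  | node {r : V} {ts : List (RTree V)} :
      (∀ t ∈ ts, IsConnSearchTree G t) →
      (∀ t ∈ ts, r ∉ t.vertSet) →
      (∀ t ∈ ts, ∃ x ∈ t.vertSet, G.Adj r x) →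
      ts.Pairwise (Separated G) →
      IsConnSearchTree G (RTree.node r ts)

section ConnSearchTree

variable {G : SimpleGraph V} {r : V} {ts : List (RTree V)} {T : RTree V}

instance : Std.Symm (Separated G) where
  symm _ _ h x hx y hy := ⟨(h y hy x hx).1.symm, fun hxy => (h y hy x hx).2 hxy.symm⟩

theorem eq_of_mem_vertSet (hsep : ts.Pairwise (Separated G)) {t t' : RTree V} (ht : t ∈ ts)
    (ht' : t' ∈ ts) {x y : V} (hx : x ∈ t.vertSet) (hy : y ∈ t'.vertSet)
    (hxy : x = y ∨ G.Adj x y) : t' = t := by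
  by_contra hne
  have := hsep.forall ht' ht hne y hy x hx
  rcases hxy with h | h
  exacts [this.1 h.symm, this.2 h.symm]

theorem compIn_eq_vertSet (hconn : ∀ t ∈ ts, ConnIn G t.vertSet) (hr : ∀ t ∈ ts, r ∉ t.vertSet)
    (hsep : ts.Pairwise (Separated G)) {t : RTree V} (ht : t ∈ ts) {x : V}
    (hx : x ∈ t.vertSet) : compIn G ((RTree.node r ts).vertSet \ {r}) x = t.vertSet := by
  refine compIn_eq_of_closed ?_ (hconn t ht) ?_ hx
  · exact fun y hy => ⟨RTree.mem_vertSet_node.2 (Or.inr ⟨t, ht, hy⟩),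
      fun h => hr t ht (Set.mem_singleton_iff.1 h ▸ hy)⟩
  · rintro a ha b ⟨hb, hbr⟩ hab
    rcases RTree.mem_vertSet_node.1 hb with h | ⟨t', ht', hb'⟩
    · exact absurd h hbr
    · obtain rfl := eq_of_mem_vertSet hsep ht ht' ha hb' (Or.inr hab)
      exact hb'

theorem IsConnSearchTree.connIn (h : IsConnSearchTree G T) : ConnIn G T.vertSet := by
  induction h with
  | @node r ts _ hr hadj hsep ih =>
    have hr' : r ∈ (RTree.node r ts).vertSet := RTree.root_mem_vertSet _
    have key : ∀ y ∈ (RTree.node r ts).vertSet, ReachIn G (RTree.node r ts).vertSet y r := by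
      intro y hy
      rcases RTree.mem_vertSet_node.1 hy with rfl | ⟨t, ht, hyt⟩
      · exact ReachIn.refl hy
      · have hsub : t.vertSet ⊆ (RTree.node r ts).vertSet :=
          fun z hz => RTree.mem_vertSet_node.2 (Or.inr ⟨t, ht, hz⟩)
        obtain ⟨x, hx, hrx⟩ := hadj t ht
        exact (((ih t ht).2 y hyt x hx).mono hsub).trans
          (ReachIn.of_adj hrx.symm (hsub hx) hr')
    exact ⟨⟨r, hr'⟩, fun x hx y hy => (key x hx).trans (key y hy).symm⟩

theorem IsConnSearchTree.isSearchTree (h : IsConnSearchTree G T) :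
    IsSearchTree G T.vertSet T := by
  induction h with
  | @node r ts hts hr hadj hsep ih =>
    have hcomp := fun t (ht : t ∈ ts) => compIn_eq_vertSet (fun t ht => (hts t ht).connIn) hr
      hsep ht t.root_mem_vertSet
    refine .node (RTree.root_mem_vertSet _) rfl (fun t ht => ?_) ?_
    · rw [hcomp t ht]
      exact ih t ht
    · refine hsep.imp_of_mem fun {t₁ t₂} h₁ h₂ h₁₂ heq => ?_
      rw [hcomp t₁ h₁, hcomp t₂ h₂] at heq
      have := t₁.root_mem_vertSet
      exact (h₁₂ _ this _ (heq ▸ this)).1 rfl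

theorem IsSearchTree.vertSet_eq {s : Set V} (h : IsSearchTree G s T) : T.vertSet = s := by
  cases h
  assumption

theorem IsSearchTree.isConnSearchTree {s : Set V} (h : IsSearchTree G s T) (hs : ConnIn G s) :
    IsConnSearchTree G T := by
  induction h with
  | @node s r ts hrs hv hts hne ih =>
    have hvert := fun t (ht : t ∈ ts) => (hts t ht).vertSet_eq
    have hroot : ∀ t ∈ ts, t.root ∈ s \ {r} := fun t ht => by
      have := t.root_mem_vertSet
      rw [hvert t ht] at this
      exact ReachIn.left_mem this
    refine .node (fun t ht => ih t ht (connIn_compIn (hroot t ht))) ?_ ?_ ?_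
    · intro t ht h
      rw [hvert t ht] at h
      exact (ReachIn.right_mem h).2 rfl
    · intro t ht
      obtain ⟨z, hz, hr⟩ := (hs.2 _ (hroot t ht).1 r hrs).exists_adj_reachIn_diff (hroot t ht).2
      exact ⟨z, by rw [hvert t ht]; exact hr, hz⟩
    · refine hne.imp_of_mem fun {t₁ t₂} h₁ h₂ h₁₂ x hx y hy => ?_
      rw [hvert t₁ h₁] at hx
      rw [hvert t₂ h₂] at hy
      have key : ¬ ReachIn G (s \ {r}) x y := fun h =>
        h₁₂ (compIn_eq_of_reachIn ((ReachIn.trans hx h).trans (ReachIn.symm hy)))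
      refine ⟨?_, fun hxy => key (ReachIn.of_adj hxy (ReachIn.right_mem hx) (ReachIn.right_mem hy))⟩
      rintro rfl
      exact key (ReachIn.refl (ReachIn.right_mem hx))

theorem IsConnSearchTree.pathSet_subset (h : IsConnSearchTree G T) (v : V) :
    T.pathSet v ⊆ T.vertSet := by
  induction h with
  | @node r ts _ _ _ _ ih =>
    rintro x ⟨p, hp, hpv, hx⟩
    rcases RTree.mem_pathsFrom_node.1 hp with rfl | ⟨t, ht, q, hq, rfl⟩
    · exact RTree.mem_vertSet_node.2 (Or.inl (by simpa using hx))
    · rcases List.mem_cons.1 hx with rfl | hx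
      · exact RTree.root_mem_vertSet _
      · exact RTree.mem_vertSet_node.2 (Or.inr ⟨t, ht, ih t ht ⟨q, hq, hpv, hx⟩⟩)

theorem finsum_mem_vertSets (hsep : ts.Pairwise (Separated G)) (f : V → ℝ) :
    ∑ᶠ x ∈ {x | ∃ t ∈ ts, x ∈ t.vertSet}, f x =
      (ts.map fun t => ∑ᶠ x ∈ t.vertSet, f x).sum := by
  induction ts with
  | nil => simp
  | cons t ts ih =>
    rw [List.pairwise_cons] at hsep
    have hset : {x | ∃ t' ∈ t :: ts, x ∈ t'.vertSet} =
        t.vertSet ∪ {x | ∃ t' ∈ ts, x ∈ t'.vertSet} := by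
      ext x
      simp
    have hfin : {x | ∃ t' ∈ ts, x ∈ t'.vertSet}.Finite := by
      refine ((List.finite_toSet ts).biUnion fun t _ => t.vertSet_finite).subset ?_
      rintro x ⟨t', ht', hx⟩
      exact Set.mem_biUnion ht' hx
    rw [hset, finsum_mem_union _ t.vertSet_finite hfin, ih hsep.2, List.map_cons, List.sum_cons]
    rw [Set.disjoint_left]
    rintro x hx ⟨t', ht', hx'⟩
    exact (hsep.1 t' ht' x hx x hx').1 rfl

theorem finsum_mem_vertSet_node (hr : ∀ t ∈ ts, r ∉ t.vertSet) (hsep : ts.Pairwise (Separated G))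
    (f : V → ℝ) :
    ∑ᶠ x ∈ (RTree.node r ts).vertSet, f x =
      f r + (ts.map fun t => ∑ᶠ x ∈ t.vertSet, f x).sum := by
  have hset : (RTree.node r ts).vertSet = insert r {x | ∃ t ∈ ts, x ∈ t.vertSet} := by
    ext x
    simp [RTree.mem_vertSet_node]
  have hfin := (RTree.node r ts).vertSet_finite
  rw [hset] at hfin ⊢
  rw [finsum_mem_insert _ _ (hfin.subset (Set.subset_insert _ _)), finsum_mem_vertSets hsep]
  rintro ⟨t, ht, h⟩
  exact hr t ht h

theorem IsConnSearchTree.wsum_node (h : IsConnSearchTree G (RTree.node r ts)) (w : V → ℝ) :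
    wsum w (RTree.node r ts).vertSet = w r + (ts.map fun t => wsum w t.vertSet).sum := by
  cases h with
  | node _ hr _ hsep => exact finsum_mem_vertSet_node hr hsep w

theorem IsConnSearchTree.cost_node (h : IsConnSearchTree G (RTree.node r ts)) (w : V → ℝ) :
    cost w (RTree.node r ts) =
      wsum w (RTree.node r ts).vertSet + (ts.map fun t => cost w t).sum := by
  rw [h.wsum_node]
  cases h with
  | node hts hr _ hsep =>
    rw [cost, finsum_mem_vertSet_node hr hsep, RTree.depth, RTree.pathSet_root hr,
      Set.ncard_singleton, Nat.cast_one, mul_one, add_assoc, ← List.sum_map_add]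
    congr 2
    refine List.map_congr_left fun t ht => ?_
    rw [wsum, cost, ← finsum_mem_add_distrib t.vertSet_finite]
    refine finsum_mem_congr rfl fun v hv => ?_
    have hvr : v ≠ r := fun h => hr t ht (h ▸ hv)
    have hrp : r ∉ t.pathSet v := fun h => hr t ht ((hts t ht).pathSet_subset v h)
    rw [RTree.depth, RTree.pathSet_child ht hv hvr
      (fun t' ht' hv' => eq_of_mem_vertSet hsep ht ht' hv hv' (Or.inl rfl)),
      Set.ncard_insert_of_notMem hrp (t.pathSet_finite v), RTree.depth]
    push_cast
    ring

theorem IsConnSearchTree.isAlphaCentroid_allSubtrees_node {w : V → ℝ} {α : ℝ}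
    (h : IsConnSearchTree G (RTree.node r ts))
    (hts : ∀ t ∈ ts, ∀ t' ∈ t.allSubtrees, IsAlphaCentroid G w α t'.vertSet t'.root)
    (hw : ∀ t ∈ ts, wsum w t.vertSet ≤ α * wsum w (RTree.node r ts).vertSet) :
    ∀ t ∈ (RTree.node r ts).allSubtrees, IsAlphaCentroid G w α t.vertSet t.root := by
  intro t ht
  rcases RTree.mem_allSubtrees_node.1 ht with rfl | ⟨t', ht', htt'⟩
  · refine ⟨RTree.root_mem_vertSet _, fun x hx => ?_⟩
    rw [RTree.root] at hx ⊢
    cases h with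
    | node hts hr _ hsep =>
      rcases RTree.mem_vertSet_node.1 hx.1 with rfl | ⟨t, ht, hxt⟩
      · exact absurd rfl hx.2
      · rw [compIn_eq_vertSet (fun t ht => (hts t ht).connIn) hr hsep ht hxt]
        exact hw t ht
  · exact hts t' ht' t htt'

theorem isConnSearchTree_leaf (v : V) : IsConnSearchTree G (RTree.node v []) :=
  .node (by simp) (by simp) (by simp) .nil

theorem IsConnSearchTree.length_children_le (h : IsConnSearchTree G (RTree.node r ts)) {D : ℕ}
    (hfin : {y | G.Adj r y}.Finite) (hD : {y | G.Adj r y}.ncard ≤ D) : ts.length ≤ D := by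
  classical
  cases h with
  | node _ _ hadj hsep =>
    have : Nonempty V := ⟨r⟩
    choose! f hf hrf using hadj
    have hnd : (ts.map f).Nodup := by
      rw [List.Nodup, List.pairwise_map]
      exact hsep.imp_of_mem fun {t₁ t₂} h₁ h₂ h => (h _ (hf t₁ h₁) _ (hf t₂ h₂)).1
    rw [← List.length_map f, ← List.toFinset_card_of_nodup hnd, ← Set.ncard_coe_finset]
    refine (Set.ncard_le_ncard ?_ hfin).trans hD
    intro y hy
    obtain ⟨t, ht, rfl⟩ := List.mem_map.1 (List.mem_toFinset.1 (Finset.mem_coe.1 hy))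
    exact hrf t ht

theorem IsConnSearchTree.le_cost (h : IsConnSearchTree G T) {w : V → ℝ} (hw : ∀ x, 0 ≤ w x)
    {ε : ℝ} (hε : ∀ x, w x ≤ ε) {D : ℕ} (hD2 : 2 ≤ D) (hfin : ∀ x, {y | G.Adj x y}.Finite)
    (hD : ∀ x, {y | G.Adj x y}.ncard ≤ D) (d : ℕ) :
    d * wsum w T.vertSet - ε * (d * (D : ℝ) ^ d) ≤ cost w T := by
  have hε0 : 0 ≤ ε := (hw T.root).trans (hε _)
  induction h generalizing d with
  | @node r ts hts hr hadj hsep ih =>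
    have hT : IsConnSearchTree G (RTree.node r ts) := .node hts hr hadj hsep
    rcases d with _ | d
    · simp only [Nat.cast_zero, zero_mul, mul_zero, sub_zero]
      exact finsum_nonneg fun x => finsum_nonneg fun _ => mul_nonneg (hw x) (Nat.cast_nonneg _)
    · rw [hT.cost_node]
      have hlen : (ts.length : ℝ) ≤ D := by
        exact_mod_cast hT.length_children_le (hfin r) (hD r)
      have h1 : (ts.map fun t => d * wsum w t.vertSet - ε * (d * (D : ℝ) ^ d)).sum ≤
          (ts.map fun t => cost w t).sum :=
        List.sum_le_sum fun t ht => ih t ht d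
      have h2 : (ts.map fun t => d * wsum w t.vertSet - ε * (d * (D : ℝ) ^ d)).sum =
          d * (ts.map fun t => wsum w t.vertSet).sum - ts.length * (ε * (d * (D : ℝ) ^ d)) := by
        generalize ε * (d * (D : ℝ) ^ d) = c
        clear * -
        induction ts with
        | nil => simp
        | cons t ts ih =>
          simp only [List.map_cons, List.sum_cons, List.length_cons, ih]
          push_cast
          ring
      have h3 := hT.wsum_node w
      have h4 : (ts.length : ℝ) * (ε * (d * (D : ℝ) ^ d)) ≤ D * (ε * (d * (D : ℝ) ^ d)) := by
        gcongr
      have h5 : (d : ℝ) * w r ≤ d * ε := by gcongr; exact hε r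
      have h6 : (d : ℝ) ≤ (D : ℝ) ^ (d + 1) := by
        exact_mod_cast (Nat.le_succ d).trans (Nat.lt_pow_self hD2).le
      have h7 : ε * d ≤ ε * (D : ℝ) ^ (d + 1) := by gcongr
      rw [h2] at h1
      push_cast
      rw [pow_succ] at h7 ⊢
      have h8 : (d : ℝ) * (ts.map fun t => wsum w t.vertSet).sum =
        d * wsum w (RTree.node r ts).vertSet - d * w r := by rw [h3]; ring
      rw [h8] at h1
      nlinarith

end ConnSearchTree

section Suffix

variable {β : Type*} {i j : β} {σ l : List β}

theorem ne_of_cons_suffix (h : j :: σ <:+ l) : l ≠ σ := by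
  rintro rfl
  have := h.length_le
  simp at this

theorem eq_of_cons_suffix (h : j :: σ <:+ l) (h' : i :: σ <:+ l) : i = j := by
  have := (List.suffix_of_suffix_length_le h' h (by simp)).eq_of_length (by simp)
  simpa using this

theorem suffix_iff_eq_or_exists_cons : σ <:+ l ↔ l = σ ∨ ∃ i, i :: σ <:+ l := by
  constructor
  · rintro ⟨t, rfl⟩
    rcases List.eq_nil_or_concat t with rfl | ⟨t, i, rfl⟩
    · exact Or.inl rfl
    · exact Or.inr ⟨i, t, by simp⟩
  · rintro (rfl | ⟨i, h⟩)
    · exact List.suffix_rfl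
    · exact (List.suffix_cons i σ).trans h

end Suffix

/-- Vertices of the subdivided complete `n`-ary tree of height `n`: `(σ, false)` is the branching
vertex reached by `σ` (last branch first), and `(σ, true)` is the subdivision vertex
immediately above it. -/
abbrev SubdivVertex (n : ℕ) : Type := {σ : List (Fin n) // σ.length ≤ n} × Bool

/-- The complete `n`-ary tree of height `n` with every edge subdivided and an extra leaf attached
to the root. -/
def subdivGraph (n : ℕ) : SimpleGraph (SubdivVertex n) :=
  SimpleGraph.fromRel fun x y =>
    x.2 = true ∧ y.2 = false ∧ (x.1.1 = y.1.1 ∨ ∃ i, x.1.1 = i :: y.1.1)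

/-- The total weight of the branch at `σ`. -/
def branchWeight (α : ℝ) {n : ℕ} (σ : List (Fin n)) : ℝ :=
  (σ.map fun i : Fin n => (1 - α) * α ^ (n - 1 - i.1)).prod

/-- The weights on the subdivided tree: subdivision vertices have weight zero. -/
noncomputable def subdivWeight (α : ℝ) {n : ℕ} (x : SubdivVertex n) : ℝ :=
  if x.2 = true then 0
  else if x.1.1.length = n then branchWeight α x.1.1 else branchWeight α x.1.1 * α ^ n

/-- The cost, relative to its weight, of searching a branch of height `k` top-down. -/
def topDownCost (α : ℝ) (n : ℕ) : ℕ → ℝ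
  | 0 => 1
  | k + 1 => 1 + (1 - α ^ n) * topDownCost α n k

section Subdiv

variable {n : ℕ} {α : ℝ}

instance : Finite {σ : List (Fin n) // σ.length ≤ n} :=
  (List.finite_length_le (Fin n) n).to_subtype

theorem subdivGraph_adj {x y : SubdivVertex n} : (subdivGraph n).Adj x y ↔
    (x.2 = true ∧ y.2 = false ∧ (x.1.1 = y.1.1 ∨ ∃ i, x.1.1 = i :: y.1.1)) ∨
    (y.2 = true ∧ x.2 = false ∧ (y.1.1 = x.1.1 ∨ ∃ i, y.1.1 = i :: x.1.1)) := by
  rw [subdivGraph, SimpleGraph.fromRel_adj, and_iff_right_iff_imp]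
  rintro (⟨h, h', -⟩ | ⟨h, h', -⟩) rfl <;> simp [h] at h'

@[simp]
theorem branchWeight_nil : branchWeight α ([] : List (Fin n)) = 1 := by
  simp [branchWeight]

theorem branchWeight_cons (i : Fin n) (σ : List (Fin n)) :
    branchWeight α (i :: σ) = (1 - α) * α ^ (n - 1 - i.1) * branchWeight α σ := by
  simp [branchWeight]

theorem branchWeight_nonneg (h0 : 0 ≤ α) (h1 : α ≤ 1) (σ : List (Fin n)) :
    0 ≤ branchWeight α σ := by
  induction σ with
  | nil => simp [branchWeight]
  | cons i σ ih =>
    rw [branchWeight_cons]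
    have : 0 ≤ 1 - α := by linarith
    positivity

theorem branchWeight_le_pow (h0 : 1 / 2 ≤ α) (h1 : α ≤ 1) (σ : List (Fin n)) :
    branchWeight α σ ≤ α ^ σ.length := by
  have hα : 0 ≤ α := by linarith
  induction σ with
  | nil => simp [branchWeight]
  | cons i σ ih =>
    rw [branchWeight_cons, List.length_cons, pow_succ']
    have h : (1 - α) * α ^ (n - 1 - i.1) ≤ α * 1 :=
      mul_le_mul (by linarith) (pow_le_one₀ hα h1) (by positivity) hα
    rw [mul_one] at h
    exact mul_le_mul h ih (branchWeight_nonneg hα h1 σ) hα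

theorem sum_branchWeight_cons (σ : List (Fin n)) :
    ∑ i : Fin n, branchWeight α (i :: σ) = branchWeight α σ * (1 - α ^ n) := by
  simp only [branchWeight_cons]
  rw [← Finset.sum_mul, ← Finset.mul_sum,
    Fin.sum_univ_eq_sum_range (fun i => α ^ (n - 1 - i)) n,
    Finset.sum_range_reflect (fun i => α ^ i) n, mul_neg_geom_sum, mul_comm]

theorem subdivWeight_nonneg (h0 : 0 ≤ α) (h1 : α ≤ 1) (x : SubdivVertex n) :
    0 ≤ subdivWeight α x := by
  have := branchWeight_nonneg h0 h1 x.1.1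
  unfold subdivWeight
  split_ifs <;> positivity

theorem subdivWeight_le (h0 : 1 / 2 ≤ α) (h1 : α ≤ 1) (x : SubdivVertex n) :
    subdivWeight α x ≤ α ^ n := by
  have hα : 0 ≤ α := by linarith
  have h := branchWeight_le_pow h0 h1 x.1.1
  unfold subdivWeight
  split_ifs with h2 h3
  · positivity
  · rwa [h3] at h
  · exact mul_le_of_le_one_left (by positivity) (h.trans (pow_le_one₀ hα h1))

theorem ncard_subdivGraph_adj_le (x : SubdivVertex n) :
    {y | (subdivGraph n).Adj x y}.ncard ≤ n + 2 := by
  classical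
  let S : Finset (List (Fin n)) :=
    insert x.1.1 (insert x.1.1.tail (Finset.univ.image fun i => i :: x.1.1))
  have hS : S.card ≤ n + 2 := by
    refine (Finset.card_insert_le _ _).trans (Nat.succ_le_succ ?_)
    refine (Finset.card_insert_le _ _).trans (Nat.succ_le_succ ?_)
    simpa using Finset.card_image_le (s := (Finset.univ : Finset (Fin n)))
      (f := fun i => i :: x.1.1)
  refine le_trans ?_ hS
  rw [← Set.ncard_coe_finset S]
  refine Set.ncard_le_ncard_of_injOn (fun y => y.1.1) ?_ ?_ S.finite_toSet
  · intro y hy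
    simp only [S, Finset.coe_insert, Set.mem_insert_iff, Finset.coe_image, Set.mem_image]
    rcases subdivGraph_adj.1 hy with ⟨-, -, h | ⟨i, h⟩⟩ | ⟨-, -, h | ⟨i, h⟩⟩
    · exact Or.inl h.symm
    · exact Or.inr (Or.inl (by rw [h, List.tail_cons]))
    · exact Or.inl h
    · exact Or.inr (Or.inr ⟨i, by simp, h.symm⟩)
  · intro y hy z hz hyz
    refine Prod.ext (Subtype.ext hyz) ?_
    rcases subdivGraph_adj.1 hy with h | h <;> rcases subdivGraph_adj.1 hz with h' | h' <;>
      simp_all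

theorem card_edgeSet_subdivGraph_le (n : ℕ) :
    Nat.card (subdivGraph n).edgeSet + 1 ≤ Nat.card (SubdivVertex n) := by
  classical
  let top : SubdivVertex n := (⟨[], by simp⟩, true)
  let parent : SubdivVertex n → SubdivVertex n := fun x =>
    if x.2 = true then (⟨x.1.1.tail, by have := x.1.2; simp; omega⟩, false) else (x.1, true)
  have hsub : (subdivGraph n).edgeSet ⊆ (fun x => s(x, parent x)) '' {x | x ≠ top} := by
    intro e
    induction e using Sym2.ind with
    | _ x y =>
      have key : ∀ x y : SubdivVertex n,
          (x.2 = true ∧ y.2 = false ∧ (x.1.1 = y.1.1 ∨ ∃ i, x.1.1 = i :: y.1.1)) →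
          s(x, y) ∈ (fun x => s(x, parent x)) '' {x | x ≠ top} := by
        rintro ⟨⟨l, hl⟩, b⟩ ⟨⟨l', hl'⟩, b'⟩ ⟨rfl, rfl, h⟩
        rcases h with rfl | ⟨i, rfl⟩
        · exact ⟨(⟨l, hl'⟩, false), by simp [top], by simp [parent]⟩
        · exact ⟨(⟨i :: l', hl⟩, true), by simp [top], by simp [parent]⟩
      intro h
      rcases subdivGraph_adj.1 ((SimpleGraph.mem_edgeSet _).1 h) with h | h
      · exact key x y h
      · rw [Sym2.eq_swap]
        exact key y x h
  rw [Nat.card_coe_set_eq]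
  have h1 := (Set.ncard_le_ncard hsub (Set.toFinite _)).trans (Set.ncard_image_le (Set.toFinite _))
  have h2 : {x : SubdivVertex n | x ≠ top}.ncard + 1 = Nat.card (SubdivVertex n) := by
    rw [← Set.ncard_univ, ← Set.ncard_insert_of_notMem (a := top) (by simp) (Set.toFinite _)]
    congr 1
    ext x
    simp [Classical.em]
  omega

theorem exists_tree_cluster (h0 : 0 ≤ α) (h1 : α ≤ 1) (σ : List (Fin n)) (hσ : σ.length ≤ n)
    (b : Bool) : ∃ T, IsConnSearchTree (subdivGraph n) T ∧
      T.vertSet = {x | x.1.1 = σ ∧ (x.2 = true → b = true)} ∧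
      wsum (subdivWeight α) T.vertSet = subdivWeight α (⟨σ, hσ⟩, false) ∧
      cost (subdivWeight α) T = subdivWeight α (⟨σ, hσ⟩, false) ∧
      ∀ t ∈ T.allSubtrees, IsAlphaCentroid (subdivGraph n) (subdivWeight α) α t.vertSet t.root := by
  have hleaf : ∀ v : SubdivVertex n,
      wsum (subdivWeight α) (RTree.node v []).vertSet = subdivWeight α v := fun v => by
    simp [(isConnSearchTree_leaf (G := subdivGraph n) v).wsum_node]
  have hleafc : ∀ v : SubdivVertex n,
      cost (subdivWeight α) (RTree.node v []) = subdivWeight α v := fun v => by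
    simp [(isConnSearchTree_leaf (G := subdivGraph n) v).cost_node, hleaf]
  have hleafa := fun v : SubdivVertex n =>
    (isConnSearchTree_leaf (G := subdivGraph n) v).isAlphaCentroid_allSubtrees_node
      (w := subdivWeight α) (α := α) (by simp) (by simp)
  cases b with
  | false =>
    refine ⟨.node (⟨σ, hσ⟩, false) [], isConnSearchTree_leaf _, ?_, hleaf _, hleafc _, hleafa _⟩
    ext ⟨⟨l, hl⟩, b⟩
    simp [RTree.mem_vertSet_node]
  | true =>
    have hu : subdivWeight α ((⟨σ, hσ⟩, true) : SubdivVertex n) = 0 := by simp [subdivWeight]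
    have hconn : IsConnSearchTree (subdivGraph n)
        (.node (⟨σ, hσ⟩, false) [.node (⟨σ, hσ⟩, true) []]) := by
      refine .node ?_ ?_ ?_ (List.pairwise_singleton _ _)
      · simpa using isConnSearchTree_leaf _
      · simp [RTree.mem_vertSet_node]
      · simpa [RTree.mem_vertSet_node, subdivGraph_adj] using hσ
    have hw := hconn.wsum_node (subdivWeight α)
    simp only [List.map_cons, List.map_nil, List.sum_cons, List.sum_nil, hleaf, hu, add_zero] at hw
    refine ⟨_, hconn, ?_, hw, ?_, hconn.isAlphaCentroid_allSubtrees_node ?_ ?_⟩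
    · ext ⟨⟨l, hl⟩, b⟩
      cases b <;> simp [RTree.mem_vertSet_node]
    · rw [hconn.cost_node, hw]
      simp [hleafc, hu]
    · simpa using hleafa _
    · simp only [List.mem_singleton, forall_eq, hleaf, hu]
      rw [hw]
      exact mul_nonneg h0 (subdivWeight_nonneg h0 h1 _)

theorem exists_topDown_tree (h0 : 0 ≤ α) (h1 : α ≤ 1) (k : ℕ) (σ : List (Fin n))
    (hσ : σ.length + k = n) : ∃ T, IsConnSearchTree (subdivGraph n) T ∧
      T.vertSet = {x | σ <:+ x.1.1} ∧
      wsum (subdivWeight α) T.vertSet = branchWeight α σ ∧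
      cost (subdivWeight α) T = branchWeight α σ * topDownCost α n k := by
  induction k generalizing σ with
  | zero =>
    obtain ⟨T, hT, hv, hw, hc, -⟩ := exists_tree_cluster h0 h1 σ (by omega) true
    have hσw : subdivWeight α ((⟨σ, by omega⟩, false) : SubdivVertex n) = branchWeight α σ := by
      simp only [subdivWeight]
      rw [if_neg (by simp), if_pos (by omega)]
    refine ⟨T, hT, ?_, hw.trans hσw, by rw [hc, hσw, topDownCost, mul_one]⟩
    rw [hv]
    ext x
    simp only [implies_true, and_true, Set.mem_ofPred_eq]
    refine ⟨fun h => by rw [h], fun h => (h.eq_of_length ?_).symm⟩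
    have h2 := h.length_le
    have h3 := x.1.2
    omega
  | succ k ih =>
    choose F hF hv hw hc using fun i : Fin n => ih (i :: σ) (by simp; omega)
    have hσ' : σ.length ≤ n := by omega
    let c : SubdivVertex n := (⟨σ, hσ'⟩, false)
    let u : SubdivVertex n := (⟨σ, hσ'⟩, true)
    have huv : (RTree.node u []).vertSet = {u} := by
      ext
      simp [RTree.mem_vertSet_node]
    have hcons : ∀ i : Fin n, (i :: σ).length ≤ n := fun i => by simp; omega
    have hconn : IsConnSearchTree (subdivGraph n)
        (.node c (.node u [] :: (List.finRange n).map F)) := by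
      refine .node ?_ ?_ ?_ ?_
      · simpa [isConnSearchTree_leaf] using hF
      · simp only [List.mem_cons, List.mem_map, List.mem_finRange, true_and, forall_eq_or_imp,
          forall_exists_index, forall_apply_eq_imp_iff, huv, hv]
        exact ⟨by simp [c, u], fun i h => ne_of_cons_suffix h rfl⟩
      · simp only [List.mem_cons, List.mem_map, List.mem_finRange, true_and, forall_eq_or_imp,
          forall_exists_index, forall_apply_eq_imp_iff, huv, hv]
        refine ⟨⟨u, rfl, subdivGraph_adj.2 (by simp [c, u])⟩, fun i => ?_⟩
        exact ⟨(⟨i :: σ, hcons i⟩, true), List.suffix_rfl, subdivGraph_adj.2 (by simp [c])⟩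
      · rw [List.pairwise_cons, List.pairwise_map]
        constructor
        · simp only [List.mem_map, List.mem_finRange, true_and, forall_exists_index,
            forall_apply_eq_imp_iff]
          intro i x hx y hy
          rw [huv, Set.mem_singleton_iff] at hx
          rw [hv] at hy
          subst hx
          refine ⟨fun h => ne_of_cons_suffix hy (by rw [← h]), fun h => ?_⟩
          rcases subdivGraph_adj.1 h with ⟨-, -, h | ⟨j, h⟩⟩ | ⟨-, h, -⟩
          · exact ne_of_cons_suffix hy h.symm
          · have h2 := congrArg List.length h
            have h3 := List.IsSuffix.length_le hy
            simp only [u, List.length_cons] at h2 h3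
            omega
          · simp [u] at h
        · refine (List.nodup_finRange n).imp fun {i j} hij x hx y hy => ?_
          rw [hv] at hx hy
          have key : ∀ {i j : Fin n} {a : Fin n} {l l' : List (Fin n)}, i ≠ j → i :: σ <:+ l →
              j :: σ <:+ l' → l ≠ a :: l' := by
            rintro i j a l l' hij h h' rfl
            rcases List.suffix_cons_iff.1 h with h | h
            · exact ne_of_cons_suffix h' (List.cons.inj h).2.symm
            · exact hij (eq_of_cons_suffix h' h)
          have hne : x.1.1 ≠ y.1.1 := fun h => hij (eq_of_cons_suffix hy (h ▸ hx))
          refine ⟨fun h => hne (by rw [h]), fun h => ?_⟩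
          rcases subdivGraph_adj.1 h with ⟨-, -, h | ⟨a, h⟩⟩ | ⟨-, -, h | ⟨a, h⟩⟩
          · exact hne h
          · exact key hij hx hy h
          · exact hne h.symm
          · exact key hij.symm hy hx h
    have hcw : subdivWeight α c = branchWeight α σ * α ^ n := by
      simp only [subdivWeight, c]
      rw [if_neg (by simp), if_neg (by omega)]
    have huw : subdivWeight α u = 0 := by simp [subdivWeight, u]
    have hleaf : wsum (subdivWeight α) (RTree.node u []).vertSet = 0 := by
      simp [(isConnSearchTree_leaf (G := subdivGraph n) u).wsum_node, huw]
    have hleafc : cost (subdivWeight α) (RTree.node u []) = 0 := by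
      rw [(isConnSearchTree_leaf (G := subdivGraph n) u).cost_node, hleaf]
      simp
    have hwsum := hconn.wsum_node (subdivWeight α)
    rw [List.map_cons, List.map_map, List.sum_cons, hleaf, hcw, zero_add, Function.comp_def,
      ← Fin.sum_univ_def] at hwsum
    simp only [hw] at hwsum
    rw [sum_branchWeight_cons] at hwsum
    replace hwsum := hwsum.trans (b := _) (c := branchWeight α σ) (by ring)
    refine ⟨_, hconn, ?_, hwsum, ?_⟩
    · ext x
      simp only [RTree.mem_vertSet_node, List.mem_cons, List.mem_map, List.mem_finRange, true_and,
        exists_eq_or_imp, exists_exists_eq_and, huv, hv, Set.mem_singleton_iff, Set.mem_ofPred_eq,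
        suffix_iff_eq_or_exists_cons (σ := σ)]
      rw [← or_assoc]
      refine or_congr_left ⟨?_, fun h => ?_⟩
      · rintro (rfl | rfl) <;> rfl
      · obtain ⟨⟨l, hl⟩, b⟩ := x
        subst h
        cases b <;> simp [c, u]
    · rw [hconn.cost_node, hwsum, List.map_cons, List.map_map, List.sum_cons, hleafc, zero_add,
        Function.comp_def, ← Fin.sum_univ_def]
      simp only [hc]
      rw [← Finset.sum_mul, sum_branchWeight_cons, topDownCost]
      ring

theorem exists_alphaCentroid_tree (h0 : 1 / 2 ≤ α) (h1 : α < 1) (k : ℕ) (σ : List (Fin n))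
    (hσ : σ.length + k = n) (b : Bool) : ∃ T, IsConnSearchTree (subdivGraph n) T ∧
      T.vertSet = {x | σ <:+ x.1.1 ∧ (x.1.1 = σ → x.2 = true → b = true)} ∧
      wsum (subdivWeight α) T.vertSet = branchWeight α σ ∧
      (1 - α) * cost (subdivWeight α) T = branchWeight α σ * (topDownCost α n k - α) ∧
      ∀ t ∈ T.allSubtrees, IsAlphaCentroid (subdivGraph n) (subdivWeight α) α t.vertSet t.root := by
  have hα : 0 ≤ α := by linarith
  induction k generalizing σ b with
  | zero =>
    obtain ⟨T, hT, hv, hw, hc, ha⟩ := exists_tree_cluster hα h1.le σ (by omega) b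
    have hσw : subdivWeight α ((⟨σ, by omega⟩, false) : SubdivVertex n) = branchWeight α σ := by
      simp only [subdivWeight]
      rw [if_neg (by simp), if_pos (by omega)]
    refine ⟨T, hT, ?_, hw.trans hσw, by rw [hc, hσw, topDownCost]; ring, ha⟩
    rw [hv]
    ext x
    simp only [Set.mem_ofPred_eq]
    have : σ <:+ x.1.1 ↔ x.1.1 = σ := by
      refine ⟨fun h => (h.eq_of_length ?_).symm, fun h => by rw [h]⟩
      have h2 := h.length_le
      have h3 := x.1.2
      omega
    rw [this]
    tauto
  | succ k ih =>
    have hσ' : σ.length ≤ n := by omega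
    have hcons : ∀ i : Fin n, (i :: σ).length ≤ n := fun i => by simp; omega
    have hcw : subdivWeight α ((⟨σ, hσ'⟩, false) : SubdivVertex n) =
        branchWeight α σ * α ^ n := by
      simp only [subdivWeight]
      rw [if_neg (by simp), if_neg (by omega)]
    have hp := branchWeight_nonneg hα h1.le σ
    have comb : ∀ j ≤ n, ∃ T, IsConnSearchTree (subdivGraph n) T ∧
        T.vertSet = {x | (x.1.1 = σ ∧ (x.2 = true → b = true)) ∨
          ∃ i : Fin n, i.1 < j ∧ i :: σ <:+ x.1.1} ∧
        wsum (subdivWeight α) T.vertSet = branchWeight α σ * α ^ (n - j) ∧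
        (1 - α) * cost (subdivWeight α) T = branchWeight α σ *
          ((1 - α) * α ^ n + (α ^ (n - j) - α ^ n) * (topDownCost α n k - α + 1)) ∧
        ∀ t ∈ T.allSubtrees,
          IsAlphaCentroid (subdivGraph n) (subdivWeight α) α t.vertSet t.root := by
      intro j
      induction j with
      | zero =>
        intro _
        obtain ⟨T, hT, hv, hw, hc, ha⟩ := exists_tree_cluster hα h1.le σ hσ' b
        refine ⟨T, hT, by simp [hv], by rw [hw, hcw, Nat.sub_zero], ?_, ha⟩
        rw [hc, hcw, Nat.sub_zero]
        ring
      | succ j ihj =>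
        intro hj
        obtain ⟨R, hR, hRv, hRw, hRc, hRa⟩ := ihj (by omega)
        obtain ⟨F, hF, hFv, hFw, hFc, hFa⟩ := ih (⟨j, hj⟩ :: σ) (by simp; omega) false
        let u : SubdivVertex n := (⟨⟨j, hj⟩ :: σ, hcons _⟩, true)
        have hFv' : ∀ x, x ∈ F.vertSet ↔ ⟨j, hj⟩ :: σ <:+ x.1.1 ∧ x ≠ u := by
          rintro ⟨⟨l, hl⟩, c⟩
          rw [hFv]
          simp [u]
        have key : ∀ x : SubdivVertex n, ⟨j, hj⟩ :: σ <:+ x.1.1 → x ∉ R.vertSet := by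
          intro x hx hxR
          rw [hRv] at hxR
          rcases hxR with ⟨h, -⟩ | ⟨i, hi, h⟩
          · exact ne_of_cons_suffix hx h
          · have := eq_of_cons_suffix hx h
            subst this
            simp at hi
        have hconn : IsConnSearchTree (subdivGraph n) (.node u [F, R]) := by
          refine .node (by simp [hF, hR]) ?_ ?_ ?_
          · simp only [List.mem_cons, List.not_mem_nil, or_false, forall_eq_or_imp, forall_eq]
            exact ⟨fun h => ((hFv' _).1 h).2 rfl, key u List.suffix_rfl⟩
          · simp only [List.mem_cons, List.not_mem_nil, or_false, forall_eq_or_imp, forall_eq]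
            refine ⟨⟨(⟨⟨j, hj⟩ :: σ, hcons _⟩, false), (hFv' _).2 ⟨List.suffix_rfl, by simp [u]⟩,
              subdivGraph_adj.2 (by simp [u])⟩, ⟨(⟨σ, hσ'⟩, false), by simp [hRv],
              subdivGraph_adj.2 (by simp [u])⟩⟩
          · rw [List.pairwise_pair]
            intro x hx y hy
            obtain ⟨hx, hxu⟩ := (hFv' x).1 hx
            have hy' : ¬ ⟨j, hj⟩ :: σ <:+ y.1.1 := fun h => key y h hy
            refine ⟨fun h => hy' (h ▸ hx), fun h => ?_⟩
            rcases subdivGraph_adj.1 h with ⟨h, -, h' | ⟨a, h'⟩⟩ | ⟨-, -, h' | ⟨a, h'⟩⟩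
            · exact hy' (h' ▸ hx)
            · rw [h'] at hx
              rcases List.suffix_cons_iff.1 hx with hx | hx
              · exact hxu (Prod.ext (Subtype.ext (h'.trans hx.symm)) h)
              · exact hy' hx
            · exact hy' (h' ▸ hx)
            · exact hy' (h' ▸ hx.trans (List.suffix_cons a _))
        have huw : subdivWeight α u = 0 := by simp [subdivWeight, u]
        have hpow : α ^ (n - j) = α ^ (n - (j + 1)) * α := by
          rw [← pow_succ]
          congr 1
          omega
        have hFw' : branchWeight α (⟨j, hj⟩ :: σ) =
            (1 - α) * α ^ (n - (j + 1)) * branchWeight α σ := by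
          rw [branchWeight_cons]
          congr 3
          show n - 1 - j = _
          omega
        rw [hFw'] at hFw hFc
        rw [hpow] at hRw hRc
        have hw := hconn.wsum_node (subdivWeight α)
        simp only [List.map_cons, List.map_nil, List.sum_cons, List.sum_nil, huw, hFw, hRw] at hw
        replace hw := hw.trans (c := branchWeight α σ * α ^ (n - (j + 1))) (by ring)
        refine ⟨_, hconn, ?_, hw, ?_, hconn.isAlphaCentroid_allSubtrees_node ?_ ?_⟩
        · ext x
          simp only [RTree.mem_vertSet_node, List.mem_cons, List.not_mem_nil, or_false,
            exists_eq_or_imp, exists_eq_left, hFv', hRv, Set.mem_ofPred_eq]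
          constructor
          · rintro (rfl | ⟨h, -⟩ | h | ⟨i, hi, h⟩)
            · exact Or.inr ⟨⟨j, hj⟩, by simp, List.suffix_rfl⟩
            · exact Or.inr ⟨⟨j, hj⟩, by simp, h⟩
            · exact Or.inl h
            · exact Or.inr ⟨i, by omega, h⟩
          · rintro (h | ⟨i, hi, h⟩)
            · exact Or.inr (Or.inr (Or.inl h))
            · rcases Nat.lt_succ_iff_lt_or_eq.1 hi with hi | hi
              · exact Or.inr (Or.inr (Or.inr ⟨i, hi, h⟩))
              · obtain rfl : i = ⟨j, hj⟩ := Fin.ext hi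
                by_cases hxu : x = u
                · exact Or.inl hxu
                · exact Or.inr (Or.inl ⟨h, hxu⟩)
        · rw [hconn.cost_node, hw]
          simp only [List.map_cons, List.map_nil, List.sum_cons, List.sum_nil, add_zero]
          rw [mul_add, mul_add, hFc, hRc]
          ring
        · simp only [List.mem_cons, List.not_mem_nil, or_false, forall_eq_or_imp, forall_eq]
          exact ⟨hFa, hRa⟩
        · simp only [List.mem_cons, List.not_mem_nil, or_false, forall_eq_or_imp, forall_eq, hFw,
            hRw]
          rw [hw]
          have : 0 ≤ branchWeight α σ * α ^ (n - (j + 1)) := by positivity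
          constructor <;> nlinarith
    obtain ⟨T, hT, hv, hw, hc, ha⟩ := comb n le_rfl
    rw [Nat.sub_self, pow_zero] at hw hc
    refine ⟨T, hT, ?_, by rw [hw, mul_one], by rw [hc, topDownCost]; ring, ha⟩
    rw [hv]
    ext x
    simp only [Set.mem_ofPred_eq, Fin.is_lt, true_and, suffix_iff_eq_or_exists_cons (σ := σ)]
    constructor
    · rintro (h | ⟨i, h⟩)
      · exact ⟨Or.inl h.1, fun _ => h.2⟩
      · exact ⟨Or.inr ⟨i, h⟩, fun h' => absurd h' (ne_of_cons_suffix h)⟩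
    · rintro ⟨h | h, h'⟩
      · exact Or.inl ⟨h, h' h⟩
      · exact Or.inr h

theorem connIn_univ_subdivGraph (n : ℕ) : ConnIn (subdivGraph n) Set.univ := by
  obtain ⟨T, hT, hv, -⟩ := exists_topDown_tree (n := n) (α := 0) le_rfl zero_le_one n [] (by simp)
  have := hT.connIn
  rwa [hv, show {x : SubdivVertex n | [] <:+ x.1.1} = Set.univ by ext; simp] at this

theorem isTree_subdivGraph (n : ℕ) : (subdivGraph n).IsTree := by
  have hconn : (subdivGraph n).Connected := by
    obtain ⟨⟨x, -⟩, h⟩ := connIn_univ_subdivGraph n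
    have : Nonempty (SubdivVertex n) := ⟨x⟩
    exact .mk fun x y => ⟨(h x trivial y trivial).choose⟩
  exact SimpleGraph.isTree_iff_connected_and_card.2 ⟨hconn,
    le_antisymm (card_edgeSet_subdivGraph_le n) hconn.card_vert_le_card_edgeSet_add_one⟩

end Subdiv

section Bounds

variable {G : SimpleGraph V} {w : V → ℝ} {s : Set V}

theorem OPT_le_cost (hw : ∀ x, 0 ≤ w x) {T : RTree V} (hT : IsSearchTree G s T) :
    OPT G w s ≤ cost w T := by
  refine csInf_le ⟨0, ?_⟩ ⟨T, hT, rfl⟩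
  rintro _ ⟨T, -, rfl⟩
  exact finsum_nonneg fun x => finsum_nonneg fun _ => mul_nonneg (hw x) (Nat.cast_nonneg _)

theorem cost_le_centCostA [Finite V] (hw : ∀ x, 0 ≤ w x) {α : ℝ} {T : RTree V}
    (hT : IsAlphaCentroidTree G w α s T) : cost w T ≤ centCostA G w α s := by
  refine le_csSup ⟨∑ᶠ v ∈ s, w v * Nat.card V, ?_⟩ ⟨T, hT, rfl⟩
  rintro _ ⟨T, hT, rfl⟩
  rw [cost, hT.1.vertSet_eq]
  rw [finsum_mem_eq_finite_toFinset_sum _ s.toFinite,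
    finsum_mem_eq_finite_toFinset_sum _ s.toFinite]
  refine Finset.sum_le_sum fun v _ => ?_
  exact mul_le_mul_of_nonneg_left (by exact_mod_cast Set.ncard_le_card _) (hw v)

end Bounds

theorem tendsto_OPT_subdivGraph {α : ℝ} (hα0 : 1 / 2 ≤ α) (hα1 : α < 1) :
    Tendsto (fun n => OPT (subdivGraph n) (subdivWeight α) Set.univ) atTop atTop := by
  rw [tendsto_atTop]
  intro b
  obtain ⟨d, hd⟩ := exists_nat_ge (b + 1)
  have hα : 0 < α := by linarith
  have hlim : Tendsto (fun n : ℕ => α ^ n * (d * ((n + 2 : ℕ) : ℝ) ^ d)) atTop (𝓝 0) := by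
    have h := ((tendsto_pow_const_mul_const_pow_of_abs_lt_one d
      (abs_lt.2 ⟨by linarith, hα1⟩)).comp (tendsto_add_atTop_nat 2)).const_mul (d / α ^ 2)
    rw [mul_zero] at h
    refine h.congr fun n => ?_
    simp only [Function.comp_apply, pow_add]
    field_simp
  filter_upwards [hlim.eventually_le_const one_pos] with n hn
  obtain ⟨T, hT, hv, hw, -⟩ := exists_topDown_tree hα.le hα1.le n ([] : List (Fin n)) (by simp)
  have huniv : {x : SubdivVertex n | [] <:+ x.1.1} = Set.univ := by ext; simp
  rw [hv, huniv] at hw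
  have hTs := hT.isSearchTree
  rw [hv, huniv] at hTs
  refine le_csInf ⟨_, T, hTs, rfl⟩ ?_
  rintro _ ⟨T', hT', rfl⟩
  have h := (hT'.isConnSearchTree (connIn_univ_subdivGraph n)).le_cost
    (subdivWeight_nonneg hα.le hα1.le) (subdivWeight_le hα0 hα1.le) (D := n + 2) (by omega)
    (fun x => Set.toFinite _) ncard_subdivGraph_adj_le d
  rw [hT'.vertSet_eq, hw] at h
  rw [branchWeight_nil, mul_one] at h
  linarith

theorem lower_bound_alpha (α : ℝ) (hα0 : 1 / 2 ≤ α) (hα1 : α < 1) :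
    ∃ (V : ℕ → Type) (_ : ∀ n, Fintype (V n)) (G : ∀ n, SimpleGraph (V n))
      (w : ∀ n, V n → ℝ),
      (∀ n, (G n).IsTree) ∧
      (∀ n x, 0 ≤ w n x) ∧
      (∀ n, wsum (w n) Set.univ = 1) ∧
      Filter.Tendsto (fun n => OPT (G n) (w n) Set.univ) Filter.atTop Filter.atTop ∧
      (∀ n, centCostA (G n) (w n) α Set.univ ≥
        (1 / (1 - α)) * OPT (G n) (w n) Set.univ - α / (1 - α)) := by
  have hα : 0 ≤ α := by linarith
  have hnonneg := fun n => subdivWeight_nonneg (n := n) hα hα1.le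
  have huniv : ∀ n, {x : SubdivVertex n | [] <:+ x.1.1} = Set.univ := fun n => by ext; simp
  refine ⟨SubdivVertex, fun n => Fintype.ofFinite _, subdivGraph, fun n => subdivWeight α,
    isTree_subdivGraph, hnonneg, fun n => ?_, tendsto_OPT_subdivGraph hα0 hα1, fun n => ?_⟩
  · obtain ⟨T, -, hv, hw, -⟩ := exists_topDown_tree hα hα1.le n ([] : List (Fin n)) (by simp)
    rw [hv, huniv] at hw
    simpa using hw
  · obtain ⟨T, hT, hv, -, hc⟩ := exists_topDown_tree hα hα1.le n ([] : List (Fin n)) (by simp)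
    obtain ⟨T', hT', hv', -, hc', ha'⟩ :=
      exists_alphaCentroid_tree hα0 hα1 n ([] : List (Fin n)) (by simp) true
    have hTs := hT.isSearchTree
    have hTs' := hT'.isSearchTree
    rw [hv, huniv] at hTs
    rw [hv', show {x : SubdivVertex n | [] <:+ x.1.1 ∧ (x.1.1 = [] → x.2 = true → true = true)} =
      Set.univ by ext; simp] at hTs'
    have h1 := OPT_le_cost (hnonneg n) hTs
    have h2 := cost_le_centCostA (hnonneg n) ⟨hTs', ha'⟩
    rw [branchWeight_nil, one_mul] at hc hc'
    have hpos : 0 < 1 - α := by linarith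
    rw [ge_iff_le, one_div_mul_eq_div, ← sub_div, div_le_iff₀ hpos]
    calc _ ≤ topDownCost α n n - α := sub_le_sub_right (h1.trans_eq hc) α
      _ = cost (subdivWeight α) T' * (1 - α) := by rw [← hc', mul_comm]
      _ ≤ _ := by gcongr
end

section
/- Let 𝒯 be a finite undirected tree and w : V(𝒯) → ℝ≥0 a weight function. For each u ∈ V(𝒯) define W(u) = Σ_{v ∈ V(𝒯)} d_𝒯(u,v)·w(v), where d_𝒯(u,v) is the number of edges on the path from u to v in 𝒯. Then a vertex c ∈ V(𝒯) is a centroid of (𝒯,w) if and only if W(c) = min_{u ∈ V(𝒯)} W(u). -/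
open Filter Topology

universe u

variable {V : Type u}

theorem wsum_eq_sum_indicator [Fintype V] (w : V → ℝ) (s : Set V) :
    wsum w s = ∑ v, s.indicator w v := by
  rw [wsum, finsum_mem_def, finsum_eq_sum_of_fintype]

theorem wsum_univ_eq_sum [Fintype V] (w : V → ℝ) : wsum w Set.univ = ∑ v, w v := by
  simp [wsum_eq_sum_indicator]

/-- A vertex outside the component of `u` in `G - c` can only be reached from `u` through `c`. -/
theorem dist_eq_dist_add_dist_of_notMem_compIn {G : SimpleGraph V} (hG : G.Connected) {c u v : V}
    (hv : v ∉ compIn G (Set.univ \ {c}) u) : G.dist u v = G.dist u c + G.dist c v := by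
  classical
  refine le_antisymm hG.dist_triangle ?_
  obtain ⟨p, hp⟩ := hG.exists_walk_length_eq_dist u v
  have hc : c ∈ p.support := by
    by_contra hc
    exact hv ⟨p, fun x hx => ⟨trivial, fun hxc => hc (hxc ▸ hx)⟩⟩
  have hlen := congrArg SimpleGraph.Walk.length (p.take_spec hc)
  rw [SimpleGraph.Walk.length_append] at hlen
  have h₁ := SimpleGraph.dist_le (p.takeUntil c hc)
  have h₂ := SimpleGraph.dist_le (p.dropUntil c hc)
  omega

/-- In a tree, moving from `c` to a neighbour `a` brings us closer to every vertex that `a`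
reaches without passing through `c`. -/
theorem SimpleGraph.IsTree.dist_add_one_le_of_reachIn {G : SimpleGraph V} (hG : G.IsTree)
    {c a v : V} (hca : G.Adj c a) (hav : ReachIn G (Set.univ \ {c}) a v) :
    G.dist a v + 1 ≤ G.dist c v := by
  classical
  obtain ⟨p, hp⟩ := hav
  have hc : c ∉ p.bypass.support := fun h => (hp c (p.support_bypass_subset_support h)).2 rfl
  have hpath : (SimpleGraph.Walk.cons hca p.bypass).IsPath := p.bypass_isPath.cons hc
  obtain ⟨q, hq, hqlen⟩ := hG.connected.exists_path_of_dist c v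
  have heq := (hG.existsUnique_path c v).unique hpath hq
  rw [← hqlen, ← heq, SimpleGraph.Walk.length_cons]
  exact Nat.add_le_add_right (SimpleGraph.dist_le _) 1

/-- Every component of `G - c` contains a neighbour of `c`. -/
theorem exists_adj_reachIn {G : SimpleGraph V} (hG : G.Connected) {c x : V} (hx : x ≠ c) :
    ∃ a, G.Adj c a ∧ ReachIn G (Set.univ \ {c}) a x := by
  obtain ⟨p, hp, -⟩ := hG.exists_path_of_dist c x
  cases p with
  | nil => exact absurd rfl hx
  | cons h p =>
    rw [SimpleGraph.Walk.cons_isPath_iff] at hp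
    exact ⟨_, h, p, fun v hv => ⟨trivial, fun hvc => hp.2 (hvc ▸ hv)⟩⟩

theorem ReachIn.trans_s17 {G : SimpleGraph V} {s : Set V} {x y z : V} (hxy : ReachIn G s x y)
    (hyz : ReachIn G s y z) : ReachIn G s x z := by
  obtain ⟨p, hp⟩ := hxy
  obtain ⟨q, hq⟩ := hyz
  refine ⟨p.append q, fun v hv => ?_⟩
  rw [SimpleGraph.Walk.mem_support_append_iff] at hv
  exact hv.elim (hp v) (hq v)

theorem centroid_iff_median {V : Type} [Fintype V]
    (G : SimpleGraph V) (hG : G.IsTree) (w : V → ℝ) (hw : ∀ x, 0 ≤ w x) (c : V) :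
    IsCentroid G w Set.univ c ↔
      ∀ u : V, ∑ v : V, (G.dist c v : ℝ) * w v ≤ ∑ v : V, (G.dist u v : ℝ) * w v := by
  classical
  constructor
  · rintro ⟨-, hc⟩ u
    by_cases hu : u = c
    · rw [hu]
    have hH := hc u ⟨trivial, hu⟩
    set H := compIn G (Set.univ \ {c}) u
    rw [wsum_univ_eq_sum, wsum_eq_sum_indicator] at hH
    have hsum : ∑ v, ((G.dist c v : ℝ) * w v + G.dist u c * (w v - 2 * H.indicator w v)) ≤
        ∑ v, (G.dist u v : ℝ) * w v := by
      refine Finset.sum_le_sum fun v _ => ?_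
      by_cases hv : v ∈ H
      · rw [Set.indicator_of_mem hv]
        have htri : (G.dist c v : ℝ) ≤ G.dist u c + G.dist u v := by
          rw [G.dist_comm (u := u) (v := c)]
          exact_mod_cast hG.connected.dist_triangle
        nlinarith [mul_le_mul_of_nonneg_right htri (hw v)]
      · rw [Set.indicator_of_notMem hv,
          dist_eq_dist_add_dist_of_notMem_compIn hG.connected hv]
        push_cast
        linarith
    rw [Finset.sum_add_distrib, ← Finset.mul_sum, Finset.sum_sub_distrib,
      ← Finset.mul_sum] at hsum
    have hgain : 0 ≤ (G.dist u c : ℝ) * (∑ v, w v - 2 * ∑ v, H.indicator w v) :=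
      mul_nonneg (Nat.cast_nonneg _) (by linarith)
    linarith
  · refine fun hmin => ⟨trivial, fun x hx => ?_⟩
    obtain ⟨a, hca, hax⟩ := exists_adj_reachIn hG.connected hx.2
    set H := compIn G (Set.univ \ {c}) x
    rw [wsum_univ_eq_sum, wsum_eq_sum_indicator]
    have hsum : ∑ v, (G.dist a v : ℝ) * w v ≤
        ∑ v, ((G.dist c v : ℝ) * w v + (w v - 2 * H.indicator w v)) := by
      refine Finset.sum_le_sum fun v _ => ?_
      by_cases hv : v ∈ H
      · rw [Set.indicator_of_mem hv]
        have hdist : (G.dist a v : ℝ) + 1 ≤ G.dist c v := by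
          exact_mod_cast hG.dist_add_one_le_of_reachIn hca (hax.trans_s17 hv)
        nlinarith [mul_le_mul_of_nonneg_right hdist (hw v)]
      · rw [Set.indicator_of_notMem hv]
        have hdist : (G.dist a v : ℝ) ≤ 1 + G.dist c v := by
          rw [← Nat.cast_one, ← SimpleGraph.dist_eq_one_iff_adj.2 hca.symm]
          exact_mod_cast hG.connected.dist_triangle
        nlinarith [mul_le_mul_of_nonneg_right hdist (hw v)]
    rw [Finset.sum_add_distrib, Finset.sum_sub_distrib, ← Finset.mul_sum] at hsum
    linarith [hmin a]
end
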